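/- The multiset {1,1,3,3,7,7,9} has exactly 182 prime 7-digit arrangements among its 630 arrangements, and this is the maximum number of prime arrangements over all multisets of seven digits all lying in {1, 3, 7, 9}. -/

import Mathlib

/-- The number of `N`-digit arrangements of the digit multiset `S`. -/
def arrCount (N : ℕ) (S : Multiset ℕ) : ℕ :=
  ((Finset.Ico (10 ^ (N - 1)) (10 ^ N)).filter
    (fun m => (Nat.digits 10 m : Multiset ℕ) = S)).card

/-- The number of prime `N`-digit arrangements of the digit multiset `S`. -/
def primeArrCount (N : ℕ) (S : Multiset ℕ) : ℕ :=
  ((Finset.Ico (10 ^ (N - 1)) (10 ^ N)).filter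
    (fun m => (Nat.digits 10 m : Multiset ℕ) = S ∧ Nat.Prime m)).card

/-- The least common multiple of `1, …, 4096`. -/
def bigF : ℕ := 3077506881670113429820742696995624946488949225075961000895394287195834502360741565171856164007686258828915116101491488583838359500058943753177909121771844441304226093380058677573137235668001832334933363996417904608767092425684403302397635729446560983745089629347009236384659739411959114704182094772851157790859725893744044869102857411319308219225628252162314136972211656457629100677293268384322302053577744397478276668504558872773783006254951594448607632024251326464532505085031403515152210364536385518052143019981254453678508057479954541489531621315306570739150747464994849403101397977484232977332852761958727306502337584143678808736155387238352416091278105847997320364772573821683249693069945314595486067135360014132360435075646637967001016175552963479821065693839497045695414776789495888334754393350831808117644737802103703843013794893017473919181594331637745773601520443467654752901661082078345577025734848165728382539606945106978808910626439417868387438222277569196120306316407770558277082046007566071246156813425304629349335583988481387587436536013600636239282621001001289955868011624651840789980100296948804414911024497262820906124896389312036719523562975186086641074170940748098571828735155830634915228459960739056629590411350451869990075357167194991371787978213495748993105321466295755952901578138894843942330808858624453644861434048577341027663911414920269790539851642923421013105273847433473785509782377996875730430424422036272344558112232762360527266114222434993160116785712695188068026374118751963870186317982957354352470305735810864322122492006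5635288859939933713033060415960979338157107720469072980604510644806045341445027645345314190890888126597045288160250428514683552233600759289271101459214666203013436741790431180840659114316559267241245075997095302435263142400000

/-- Checks that `lo + 1, …, lo + 2 ^ k` all divide `bigF`. -/
def chkDvd : ℕ → ℕ → Bool
  | 0, lo => Nat.beq (bigF % (lo + 1)) 0
  | k + 1, lo => bif chkDvd k lo then chkDvd k (lo + 2 ^ k) else false

theorem chkDvd_big : chkDvd 12 0 = true := by decide +kernel

theorem dvd_of_chk (k : ℕ) : ∀ lo m : ℕ, chkDvd k lo = true → lo < m → m ≤ lo + 2 ^ k →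
    m ∣ bigF := by
  induction k with
  | zero =>
    intro lo m h h1 h2
    rw [chkDvd, Nat.beq_eq] at h
    obtain rfl : m = lo + 1 := by omega
    exact Nat.dvd_of_mod_eq_zero h
  | succ k ih =>
    intro lo m h h1 h2
    rw [chkDvd] at h
    cases h3 : chkDvd k lo with
    | false => simp [h3] at h
    | true =>
      rw [h3, cond_true] at h
      by_cases hm : m ≤ lo + 2 ^ k
      · exact ih lo m h3 h1 hm
      · exact ih _ m h (by omega) (by rw [pow_succ] at h2; omega)

/-- The product of `lo + 1, …, lo + 2 ^ k`. -/
def prodTree : ℕ → ℕ → ℕ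
  | 0, lo => lo + 1
  | k + 1, lo => prodTree k lo * prodTree k (lo + 2 ^ k)

theorem le_of_dvd_prodTree (p : ℕ) (hp : p.Prime) (k : ℕ) :
    ∀ lo : ℕ, p ∣ prodTree k lo → p ≤ lo + 2 ^ k := by
  induction k with
  | zero =>
    intro lo h
    exact Nat.le_of_dvd (Nat.succ_pos lo) h
  | succ k ih =>
    intro lo h
    rw [prodTree] at h
    rw [pow_succ]
    rcases hp.dvd_mul.1 h with h | h
    · have := ih _ h
      omega
    · have := ih _ h
      omega

theorem bigF_dvd : Nat.beq (prodTree 12 0 % bigF) 0 = true := by decide +kernel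

theorem le_of_dvd_bigF (p : ℕ) (hp : p.Prime) (h : p ∣ bigF) : p ≤ 4096 := by
  have := le_of_dvd_prodTree p hp 12 0
    (h.trans (Nat.dvd_of_mod_eq_zero (Nat.eq_of_beq_eq_true bigF_dvd)))
  simpa using this

/-- Primality test for seven-digit numbers. -/
def isP (m : ℕ) : Bool := Nat.beq (Nat.gcd bigF m) 1

theorem isP_iff (m : ℕ) (h1 : 10 ^ 6 ≤ m) (h2 : m < 10 ^ 7) : isP m = true ↔ m.Prime := by
  have e : isP m = true ↔ Nat.gcd bigF m = 1 := by
    rw [isP, Nat.beq_eq]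
  rw [e]
  constructor
  · intro hg
    by_contra hn
    have hm : m ≠ 1 := by omega
    have hsq := Nat.minFac_sq_le_self (by omega) hn
    have hle : m.minFac ≤ 3162 := by nlinarith
    have hd := Nat.dvd_gcd (dvd_of_chk 12 0 _ chkDvd_big (Nat.minFac_pos m) (hle.trans (by norm_num))) (Nat.minFac_dvd m)
    rw [hg] at hd
    exact (Nat.minFac_prime hm).one_lt.ne' (Nat.dvd_one.1 hd)
  · intro hp
    rw [Nat.gcd_comm]
    refine (Nat.Prime.coprime_iff_not_dvd hp).2 fun hd => ?_
    have := le_of_dvd_bigF m hp hd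
    omega

/-- Arrangements with `a` ones, `b` threes, `c` sevens and `d` nines. -/
def arrs : ℕ → ℕ → ℕ → ℕ → ℕ → List ℕ
  | 0, 0, 0, 0, 0 => [0]
  | 0, _, _, _, _ => []
  | n + 1, a, b, c, d =>
    (match a with | 0 => [] | a + 1 => (arrs n a b c d).map (fun x => 10 * x + 1)) ++
    ((match b with | 0 => [] | b + 1 => (arrs n a b c d).map (fun x => 10 * x + 3)) ++
    ((match c with | 0 => [] | c + 1 => (arrs n a b c d).map (fun x => 10 * x + 7)) ++
    (match d with | 0 => [] | d + 1 => (arrs n a b c d).map (fun x => 10 * x + 9))))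

theorem arrs_succ (n a b c d : ℕ) : arrs (n + 1) a b c d =
    (match a with | 0 => [] | a + 1 => (arrs n a b c d).map (fun x => 10 * x + 1)) ++
    ((match b with | 0 => [] | b + 1 => (arrs n a b c d).map (fun x => 10 * x + 3)) ++
    ((match c with | 0 => [] | c + 1 => (arrs n a b c d).map (fun x => 10 * x + 7)) ++
    (match d with | 0 => [] | d + 1 => (arrs n a b c d).map (fun x => 10 * x + 9)))) := by
  cases a <;> cases b <;> cases c <;> cases d <;> rfl

/-- Counts the list elements passing the test. -/
def cntP : List ℕ → ℕ
  | [] => 0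
  | x :: l => bif isP x then cntP l + 1 else cntP l

set_option maxRecDepth 100000 in
theorem cnt_main : cntP (arrs 7 2 2 2 1) = 182 := by decide +kernel

set_option maxRecDepth 100000 in
theorem len_main : (arrs 7 2 2 2 1).length = 630 := by decide +kernel

set_option maxRecDepth 100000 in
theorem cnt_all : ∀ a < 8, ∀ b < 8 - a, ∀ c < 8 - a - b,
    cntP (arrs 7 a b c (7 - a - b - c)) ≤ 182 := by decide +kernel

theorem cntP_eq (l : List ℕ) : cntP l = (l.filter isP).length := by
  induction l with
  | nil => rfl
  | cons x l ih => cases h : isP x <;> simp [cntP, h, ih]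

/-- The digit list has the prescribed length, digit counts, and digits in `{1,3,7,9}`. -/
def Good (n a b c d : ℕ) (l : List ℕ) : Prop :=
  l.length = n ∧ l.count 1 = a ∧ l.count 3 = b ∧ l.count 7 = c ∧ l.count 9 = d ∧
    ∀ x ∈ l, x = 1 ∨ x = 3 ∨ x = 7 ∨ x = 9

theorem mem_arrs (n : ℕ) : ∀ a b c d m : ℕ,
    m ∈ arrs n a b c d ↔ Good n a b c d (Nat.digits 10 m) := by
  induction n with
  | zero =>
    intro a b c d m
    constructor
    · intro h
      unfold arrs at h
      split at h <;> simp_all [Good]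
    · rintro ⟨h0, h1, h2, h3, h4, -⟩
      rw [List.length_eq_zero_iff] at h0
      rw [h0] at h1 h2 h3 h4
      rw [Nat.digits_eq_nil_iff_eq_zero] at h0
      simp at h1 h2 h3 h4
      subst h0 h1 h2 h3 h4
      simp [arrs]
  | succ n ih =>
    intro a b c d m
    have dg : ∀ x k, 0 < k → k < 10 → Nat.digits 10 (10 * x + k) = k :: Nat.digits 10 x := by
      intro x k h0 h1
      rw [add_comm, Nat.digits_add 10 (by norm_num) k x h1 (Or.inl h0.ne')]
    rw [arrs_succ]
    simp only [List.mem_append]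
    constructor
    · rintro (h | h | h | h)
      all_goals
        split at h
        · simp at h
        · obtain ⟨x, hx, rfl⟩ := List.mem_map.1 h
          obtain ⟨h0, h1, h2, h3, h4, h5⟩ := (ih _ _ _ _ _).1 hx
          rw [dg _ _ (by norm_num) (by norm_num)]
          refine ⟨by simp [h0], by simp [h1], by simp [h2], by simp [h3], by simp [h4], ?_⟩
          intro y hy
          rcases List.mem_cons.1 hy with rfl | hy
          · simp
          · exact h5 y hy
    · rintro ⟨h0, h1, h2, h3, h4, h5⟩
      have hm : m ≠ 0 := by
        rintro rfl
        simp at h0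
      have e : Nat.digits 10 m = (m % 10) :: Nat.digits 10 (m / 10) :=
        Nat.digits_def' (by norm_num) (Nat.pos_of_ne_zero hm)
      rw [e] at h0 h1 h2 h3 h4 h5
      have hk := h5 (m % 10) (by simp)
      have h5' : ∀ x ∈ Nat.digits 10 (m / 10), x = 1 ∨ x = 3 ∨ x = 7 ∨ x = 9 :=
        fun x hx => h5 x (List.mem_cons_of_mem _ hx)
      have hdm := Nat.div_add_mod m 10
      rcases hk with hk | hk | hk | hk <;> rw [hk] at h0 h1 h2 h3 h4 hdm <;>
        simp at h0 h1 h2 h3 h4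
      · left
        subst h1
        exact List.mem_map.2 ⟨m / 10, (ih _ _ _ _ _).2 ⟨h0, rfl, h2, h3, h4, h5'⟩, hdm⟩
      · right; left
        subst h2
        exact List.mem_map.2 ⟨m / 10, (ih _ _ _ _ _).2 ⟨h0, h1, rfl, h3, h4, h5'⟩, hdm⟩
      · right; right; left
        subst h3
        exact List.mem_map.2 ⟨m / 10, (ih _ _ _ _ _).2 ⟨h0, h1, h2, rfl, h4, h5'⟩, hdm⟩
      · right; right; right
        subst h4
        exact List.mem_map.2 ⟨m / 10, (ih _ _ _ _ _).2 ⟨h0, h1, h2, h3, rfl, h5'⟩, hdm⟩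

theorem nodup_arrs (n : ℕ) : ∀ a b c d : ℕ, (arrs n a b c d).Nodup := by
  induction n with
  | zero =>
    intro a b c d
    unfold arrs
    split <;> simp_all
  | succ n ih =>
    intro a b c d
    have hn : ∀ k a b c d, ((arrs n a b c d).map (fun x => 10 * x + k)).Nodup := by
      intro k a b c d
      refine (ih a b c d).map ?_
      intro x y h
      simp only at h
      omega
    rw [arrs_succ]
    simp only [List.nodup_append']
    refine ⟨?_, ⟨?_, ⟨?_, ?_, ?_⟩, ?_⟩, ?_⟩
    · split
      · simp
      · exact hn _ _ _ _ _
    · split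
      · simp
      · exact hn _ _ _ _ _
    · split
      · simp
      · exact hn _ _ _ _ _
    · split
      · simp
      · exact hn _ _ _ _ _
    all_goals
      cases a <;> cases b <;> cases c <;> cases d <;> intro x h1 h2 <;>
        simp only [List.mem_append, List.mem_map, List.not_mem_nil, false_or, or_false] at h1 h2 <;>
        grind

theorem good_iff (S : Multiset ℕ) (hS : Multiset.card S = 7)
    (hd : ∀ d ∈ S, d = 1 ∨ d = 3 ∨ d = 7 ∨ d = 9) (l : List ℕ) :
    (l : Multiset ℕ) = S ↔ Good 7 (S.count 1) (S.count 3) (S.count 7) (S.count 9) l := by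
  constructor
  · rintro rfl
    exact ⟨by simpa using hS, by simp, by simp, by simp, by simp, by simpa using hd⟩
  · rintro ⟨-, h1, h2, h3, h4, h5⟩
    ext x
    rw [Multiset.coe_count]
    by_cases hx : x = 1 ∨ x = 3 ∨ x = 7 ∨ x = 9
    · rcases hx with rfl | rfl | rfl | rfl <;> assumption
    · rw [List.count_eq_zero_of_not_mem fun h => hx (h5 x h),
        Multiset.count_eq_zero_of_notMem fun h => hx (hd x h)]

theorem range_of_good {a b c d m : ℕ} (h : Good 7 a b c d (Nat.digits 10 m)) :
    10 ^ 6 ≤ m ∧ m < 10 ^ 7 := by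
  have h0 := h.1
  constructor
  · by_contra hlt
    have := (Nat.digits_length_le_iff (b := 10) (k := 6) (by norm_num) m).2 (by omega)
    omega
  · exact (Nat.digits_length_le_iff (b := 10) (k := 7) (by norm_num) m).1 h0.le

theorem arrCount_eq (S : Multiset ℕ) (hS : Multiset.card S = 7)
    (hd : ∀ d ∈ S, d = 1 ∨ d = 3 ∨ d = 7 ∨ d = 9) :
    arrCount 7 S = (arrs 7 (S.count 1) (S.count 3) (S.count 7) (S.count 9)).length := by
  rw [← List.toFinset_card_of_nodup (nodup_arrs _ _ _ _ _), arrCount]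
  congr 1
  ext m
  rw [Finset.mem_filter, Finset.mem_Ico, List.mem_toFinset, mem_arrs, good_iff S hS hd]
  exact ⟨fun h => h.2, fun h => ⟨range_of_good h, h⟩⟩

theorem primeArrCount_eq (S : Multiset ℕ) (hS : Multiset.card S = 7)
    (hd : ∀ d ∈ S, d = 1 ∨ d = 3 ∨ d = 7 ∨ d = 9) :
    primeArrCount 7 S = cntP (arrs 7 (S.count 1) (S.count 3) (S.count 7) (S.count 9)) := by
  rw [cntP_eq, ← List.toFinset_card_of_nodup ((nodup_arrs _ _ _ _ _).filter _), primeArrCount]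
  congr 1
  ext m
  rw [Finset.mem_filter, Finset.mem_Ico, List.mem_toFinset, List.mem_filter, mem_arrs,
    good_iff S hS hd]
  constructor
  · rintro ⟨h, h1, h2⟩
    exact ⟨h1, (isP_iff m h.1 h.2).2 h2⟩
  · rintro ⟨h1, h2⟩
    have h := range_of_good h1
    exact ⟨h, h1, (isP_iff m h.1 h.2).1 h2⟩

theorem card_eq_counts (S : Multiset ℕ) (hd : ∀ d ∈ S, d = 1 ∨ d = 3 ∨ d = 7 ∨ d = 9) :
    Multiset.card S = S.count 1 + S.count 3 + S.count 7 + S.count 9 := by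
  induction S using Multiset.induction_on with
  | empty => simp
  | cons x S ih =>
    have := ih fun d h => hd d (Multiset.mem_cons_of_mem h)
    rcases hd x (Multiset.mem_cons_self x S) with rfl | rfl | rfl | rfl <;>
      simp <;> omega

/-- The multiset `{1,1,3,3,7,7,9}` has exactly 182 prime 7-digit arrangements
among its 630 arrangements, the maximum over all multisets of seven digits all
lying in {1, 3, 7, 9}. -/
theorem stmt_17 :
    primeArrCount 7 {1, 1, 3, 3, 7, 7, 9} = 182 ∧
    arrCount 7 {1, 1, 3, 3, 7, 7, 9} = 630 ∧
    (∀ S : Multiset ℕ, Multiset.card S = 7 →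
      (∀ d ∈ S, d = 1 ∨ d = 3 ∨ d = 7 ∨ d = 9) → primeArrCount 7 S ≤ 182) := by
  have hS : Multiset.card ({1, 1, 3, 3, 7, 7, 9} : Multiset ℕ) = 7 := by decide
  have hd : ∀ d ∈ ({1, 1, 3, 3, 7, 7, 9} : Multiset ℕ), d = 1 ∨ d = 3 ∨ d = 7 ∨ d = 9 := by
    decide
  have c1 : ({1, 1, 3, 3, 7, 7, 9} : Multiset ℕ).count 1 = 2 := by decide
  have c3 : ({1, 1, 3, 3, 7, 7, 9} : Multiset ℕ).count 3 = 2 := by decide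
  have c7 : ({1, 1, 3, 3, 7, 7, 9} : Multiset ℕ).count 7 = 2 := by decide
  have c9 : ({1, 1, 3, 3, 7, 7, 9} : Multiset ℕ).count 9 = 1 := by decide
  refine ⟨?_, ?_, ?_⟩
  · rw [primeArrCount_eq _ hS hd, c1, c3, c7, c9, cnt_main]
  · rw [arrCount_eq _ hS hd, c1, c3, c7, c9, len_main]
  · intro S hS hd
    rw [primeArrCount_eq S hS hd]
    have h := card_eq_counts S hd
    rw [hS] at h
    have := cnt_all (S.count 1) (by omega) (S.count 3) (by omega) (S.count 7) (by omega)
    rwa [show 7 - S.count 1 - S.count 3 - S.count 7 = S.count 9 by omega] at this
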